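/- Let P be a finite nonempty subset of a metric space M, let k, ℓ be integers with 1 ≤ ℓ ≤ k ≤ |P|, and set m = ⌊k/ℓ⌋. Let c ≥ 0 be a real number and let Q ⊆ P with |Q| = m satisfy max_{p ∈ P} dist_1(Q, p) ≤ c·r_cen. Let C ⊆ P be any set such that for every q ∈ Q, C contains at least ℓ points of P each within distance dist_ℓ(P, q) of q (equivalently, dist_ℓ(C, q) = dist_ℓ(P, q)). Then max_{p ∈ P} dist_ℓ(C, p) ≤ r_opt + 2c·r_cen. -/

import Mathlib

/-- `kthDist S p i` is the `i`-th smallest value (1-indexed) among the distances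
`dist p s` for `s ∈ S`, i.e. the radius of the smallest closed ball centered at `p`
containing at least `i` points of `S`. -/
noncomputable def kthDist {M : Type*} [MetricSpace M] (S : Finset M) (p : M) (i : ℕ) : ℝ :=
  ((S.val.map (fun s => dist p s)).sort (· ≤ ·)).getD (i - 1) 0

/-- In a sorted list, the entry at index `j` is at most `r` iff more than `j` entries are. -/
theorem List.getD_le_iff_lt_countP {L : List ℝ} (hL : L.Pairwise (· ≤ ·)) (r d : ℝ) {j : ℕ}
    (hj : j < L.length) : L.getD j d ≤ r ↔ j < L.countP (fun x => decide (x ≤ r)) := by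
  induction L generalizing j with
  | nil => simp at hj
  | cons a L ih =>
    rw [List.pairwise_cons] at hL
    obtain ⟨ha, hL⟩ := hL
    by_cases har : a ≤ r
    · cases j with
      | zero => simp [har]
      | succ j =>
        have hj' : j < L.length := by simpa using hj
        simpa [har] using ih hL hj'
    · have hzero : L.countP (fun x => decide (x ≤ r)) = 0 := by
        rw [List.countP_eq_zero]
        intro x hx hxr
        exact har ((ha x hx).trans (by simpa using hxr))
      cases j with
      | zero => simp [har, hzero]
      | succ j =>
        have hj' : j < L.length := by simpa using hj
        simpa [har, hzero] using ih hL hj'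

/-- The `i`-th smallest distance from `p` to `S` is at most `r` iff the closed ball of radius `r`
around `p` contains at least `i` points of `S`. -/
theorem kthDist_le_iff {M : Type*} [MetricSpace M] {S : Finset M} {p : M} {i : ℕ} {r : ℝ}
    (hi : 1 ≤ i) (hiS : i ≤ S.card) :
    kthDist S p i ≤ r ↔ i ≤ (S.filter (fun x => dist p x ≤ r)).card := by
  unfold kthDist
  have hlen : i - 1 < ((S.val.map (fun s => dist p s)).sort (· ≤ ·)).length := by
    rw [Multiset.length_sort, Multiset.card_map, Finset.card_val]
    omega
  rw [List.getD_le_iff_lt_countP (Multiset.pairwise_sort _ _) r 0 hlen]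
  have hcount : ((S.val.map (fun s => dist p s)).sort (· ≤ ·)).countP (fun x => decide (x ≤ r))
      = (S.filter (fun x => dist p x ≤ r)).card := by
    have h := Multiset.coe_countP (· ≤ r) ((S.val.map (fun s => dist p s)).sort (· ≤ ·))
    rw [← h, Multiset.sort_eq, Multiset.countP_map]
    rfl
  omega

/-- Let `P` be a finite nonempty subset of a metric space,
`1 ≤ ℓ ≤ k ≤ |P|`, `m = ⌊k/ℓ⌋`.  Let `c ≥ 0` and let `Q ⊆ P` with `|Q| = m` satisfy
`max_{p ∈ P} dist_1(Q, p) ≤ c·r_cen`.  Let `C ⊆ P` be any set such that for every `q ∈ Q`,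
`C` contains at least `ℓ` points of `P` each within distance `dist_ℓ(P, q)` of `q`.
Then `max_{p ∈ P} dist_ℓ(C, p) ≤ r_opt + 2c·r_cen`. -/
theorem center_cost_le_opt_add_two_c_cen {M : Type*} [MetricSpace M]
    (P : Finset M) (hP : P.Nonempty) (k ℓ : ℕ)
    (hl1 : 1 ≤ ℓ) (hlk : ℓ ≤ k) (hkP : k ≤ P.card)
    (ropt rcen : ℝ)
    (hopt : IsLeast {x : ℝ | ∃ C : Finset M, C ⊆ P ∧ C.card = k ∧
      x = P.sup' hP (fun p => kthDist C p ℓ)} ropt)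
    (hcen : IsLeast {x : ℝ | ∃ Q : Finset M, Q ⊆ P ∧ Q.card = k / ℓ ∧
      x = P.sup' hP (fun p => kthDist Q p 1)} rcen)
    (c : ℝ) (hc : 0 ≤ c)
    (Q : Finset M) (hQP : Q ⊆ P) (hQcard : Q.card = k / ℓ)
    (hQapprox : P.sup' hP (fun p => kthDist Q p 1) ≤ c * rcen)
    (C : Finset M) (hCP : C ⊆ P)
    (hC : ∀ q ∈ Q, ℓ ≤ (C.filter (fun x => dist q x ≤ kthDist P q ℓ)).card) :
    P.sup' hP (fun p => kthDist C p ℓ) ≤ ropt + 2 * c * rcen := by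
  obtain ⟨⟨D, hDP, hDcard, hD⟩, -⟩ := hopt
  have hball : ∀ q ∈ P, kthDist P q ℓ ≤ ropt := by
    intro q hq
    have hDq : kthDist D q ℓ ≤ ropt := hD ▸ P.le_sup' (fun p => kthDist D p ℓ) hq
    rw [kthDist_le_iff hl1 (hDcard ▸ hlk)] at hDq
    rw [kthDist_le_iff hl1 (hlk.trans hkP)]
    exact hDq.trans (Finset.card_le_card (Finset.filter_subset_filter _ hDP))
  have hQ1 : 1 ≤ Q.card := hQcard ▸ Nat.div_pos hlk hl1
  refine Finset.sup'_le _ _ fun p hp => ?_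
  have hpQ : kthDist Q p 1 ≤ c * rcen :=
    (P.le_sup' (fun p => kthDist Q p 1) hp).trans hQapprox
  rw [kthDist_le_iff le_rfl hQ1, Nat.one_le_iff_ne_zero, Finset.card_ne_zero] at hpQ
  obtain ⟨q, hq⟩ := hpQ
  obtain ⟨hqQ, hpq⟩ := Finset.mem_filter.1 hq
  have hCq := hC q hqQ
  rw [kthDist_le_iff hl1 (hCq.trans (Finset.card_filter_le _ _))]
  refine hCq.trans (Finset.card_le_card fun x hx => ?_)
  obtain ⟨hxC, hqx⟩ := Finset.mem_filter.1 hx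
  refine Finset.mem_filter.2 ⟨hxC, ?_⟩
  have hqopt := hball q (hQP hqQ)
  have htri := dist_triangle p q x
  have hnonneg : 0 ≤ dist p q := dist_nonneg
  linarith
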